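/- Fix 1/2 < δ < 1. There exists M₀ ∈ ℕ such that for every integer M ≥ M₀, taking the alphabet A = { l ∈ {0,…,M−1} : |l − M/2| ≤ M^δ/2 } and C_k the associated discrete Cantor set, one has for every k ≥ 1 the lower bound ‖𝟙_{C_k} F_{M^k} 𝟙_{C_k}‖ ≥ (M^k)^{−β₀} with β₀ = 170·e^{−(π/4)·M^{2δ−1}}. (This expresses that the fractal uncertainty exponent β = −lim_{k→∞} log‖𝟙_{C_k} F_{M^k} 𝟙_{C_k}‖/(k·log M) satisfies β ≤ 170·e^{−(π/4)·M^{2δ−1}}.) -/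

import Mathlib

open scoped Classical

noncomputable section

/-- `e^{-2πi x}` -/
def ec (x : ℝ) : ℂ := Complex.exp (-(2 * Real.pi * x) * Complex.I)

/-- The discrete Fourier transform matrix `F_N`, with entries `N^{-1/2} e^{-2πi jl/N}`. -/
def dftMatrix (N : ℕ) : Matrix (Fin N) (Fin N) ℂ :=
  Matrix.of fun j l : Fin N => ((Real.sqrt N)⁻¹ : ℝ) * ec ((j : ℕ) * (l : ℕ) / (N : ℝ))

/-- Multiplication by the indicator function of `S`, as a matrix on `ℂ^N`. -/
def indicatorMatrix (N : ℕ) (S : Finset ℕ) : Matrix (Fin N) (Fin N) ℂ :=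
  Matrix.diagonal fun j => if (j : ℕ) ∈ S then 1 else 0

/-- The discrete Cantor set `C_k = {a₀ + a₁ M + ⋯ + a_{k-1} M^{k-1} : a_j ∈ A}`. -/
def cantorC (M k : ℕ) (A : Finset ℕ) : Finset ℕ :=
  (Fintype.piFinset fun _ : Fin k => A).image fun a => ∑ j : Fin k, a j * M ^ (j : ℕ)

/-- The operator norm of a matrix acting on `ℂ^N` with the ℓ² norm. -/
def opNorm {N : ℕ} (A : Matrix (Fin N) (Fin N) ℂ) : ℝ :=
  ‖Matrix.toEuclideanCLM (𝕜 := ℂ) A‖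

/-- The alphabet `A = { l ∈ {0,…,M-1} : |l - M/2| ≤ M^δ/2 }`. -/
def alphabetA (M : ℕ) (δ : ℝ) : Finset ℕ :=
  (Finset.range M).filter fun l => |(l : ℝ) - (M : ℝ) / 2| ≤ (M : ℝ) ^ δ / 2

lemma hlp_ec_add (x y : ℝ) : ec (x + y) = ec x * ec y := by
  unfold ec; rw [← Complex.exp_add]; congr 1; push_cast; ring

lemma hlp_norm_ec (x : ℝ) : ‖ec x‖ = 1 := by
  unfold ec
  have : (-(2 * Real.pi * x) * Complex.I : ℂ) = ((-(2 * Real.pi * x) : ℝ) : ℂ) * Complex.I := by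
    push_cast; ring
  rw [this]; exact Complex.norm_exp_ofReal_mul_I _

lemma hlp_ec_nat (n : ℕ) : ec n = 1 := by
  unfold ec
  rw [Complex.exp_eq_one_iff]
  exact ⟨-n, by push_cast; ring⟩

lemma hlp_ec_pow (x : ℝ) (n : ℕ) : ec x ^ n = ec (n * x) := by
  unfold ec; rw [← Complex.exp_nat_mul]; congr 1; push_cast; ring

lemma hlp_ec_conj (x : ℝ) : (starRingEnd ℂ) (ec x) = ec (-x) := by
  unfold ec; rw [← Complex.exp_conj]; congr 1; simp [Complex.conj_ofNat]

lemma hlp_ec_eq_one {x : ℝ} (h : ec x = 1) : ∃ n : ℤ, x = n := by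
  unfold ec at h
  rw [Complex.exp_eq_one_iff] at h
  obtain ⟨n, hn⟩ := h
  refine ⟨-n, ?_⟩
  have h2 : (2 * Real.pi * Complex.I : ℂ) ≠ 0 := Complex.two_pi_I_ne_zero
  have : (x : ℂ) = ((-n : ℤ) : ℂ) := by
    apply mul_left_cancel₀ h2
    push_cast
    linear_combination -hn
  exact_mod_cast this

lemma hlp_sum_mul (M N : ℕ) {E : Type*} [AddCommMonoid E] (h : ℕ → E) :
    ∑ l ∈ Finset.range (N * M), h l
      = ∑ m ∈ Finset.range N, ∑ a ∈ Finset.range M, h (m + N * a) := by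
  rw [Finset.sum_comm]
  induction M with
  | zero => simp
  | succ M ih =>
    rw [Nat.mul_succ, Finset.sum_range_add, ih, Finset.sum_range_succ]
    simp [add_comm]

/-- the one-step exponential sum -/
def hlpG (M : ℕ) (f : ℕ → ℂ) (x : ℝ) : ℂ := ∑ l ∈ Finset.range M, f l * ec (l * x)

def hlpU (M : ℕ) (f : ℕ → ℂ) : ℕ → ℕ → ℂ
  | 0, _ => 1
  | k + 1, l => hlpU M f k (l % M ^ k) * f (l / M ^ k)

lemma hlpU_succ (M : ℕ) (f : ℕ → ℂ) (k m a : ℕ) (hm : m < M ^ k) :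
    hlpU M f (k + 1) (m + M ^ k * a) = hlpU M f k m * f a := by
  have h0 : 0 < M ^ k := by omega
  simp [hlpU, Nat.mod_eq_of_lt hm, Nat.add_mul_div_left _ _ h0, Nat.div_eq_of_lt hm]

def hlpS (M : ℕ) (f : ℕ → ℂ) (k : ℕ) (x : ℝ) : ℂ :=
  ∑ l ∈ Finset.range (M ^ k), hlpU M f k l * ec (l * x)

lemma hlpS_succ (M : ℕ) (f : ℕ → ℂ) (k : ℕ) (x : ℝ) :
    hlpS M f (k + 1) x = hlpS M f k x * hlpG M f (M ^ k * x) := by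
  unfold hlpS hlpG
  rw [pow_succ, hlp_sum_mul, Finset.sum_mul_sum]
  refine Finset.sum_congr rfl fun m hm => Finset.sum_congr rfl fun a _ => ?_
  rw [hlpU_succ M f k m a (Finset.mem_range.1 hm)]
  have : ((m + M ^ k * a : ℕ) : ℝ) * x = m * x + a * (M ^ k * x) := by push_cast; ring
  rw [this, hlp_ec_add]; ring

lemma hlpS_prod (M : ℕ) (f : ℕ → ℂ) (k : ℕ) (x : ℝ) :
    hlpS M f k x = ∏ b ∈ Finset.range k, hlpG M f (M ^ b * x) := by
  induction k with
  | zero => simp [hlpS, hlpU]; simpa using hlp_ec_nat 0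
  | succ k ih => rw [hlpS_succ, ih, Finset.prod_range_succ]

lemma hlpS_per (M : ℕ) (f : ℕ → ℂ) (k : ℕ) (x : ℝ) (a : ℕ) :
    hlpS M f k (x + a) = hlpS M f k x := by
  unfold hlpS
  refine Finset.sum_congr rfl fun l _ => ?_
  have : (l : ℝ) * (x + a) = l * x + ((l * a : ℕ) : ℝ) := by push_cast; ring
  rw [this, hlp_ec_add, hlp_ec_nat, mul_one]

lemma hlpS_step (M : ℕ) (hM : 0 < M) (f : ℕ → ℂ) (k m a : ℕ) :
    hlpS M f (k + 1) (((m + M ^ k * a : ℕ) : ℝ) / (M : ℝ) ^ (k + 1))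
      = hlpS M f k ((m : ℝ) / (M : ℝ) ^ k) * hlpG M f ((a + (m : ℝ) / (M : ℝ) ^ k) / M) := by
  have hM' : (M : ℝ) ≠ 0 := by positivity
  rw [hlpS_prod, Finset.prod_range_succ']
  have e1 : (M : ℝ) ^ 0 * (((m + M ^ k * a : ℕ) : ℝ) / (M : ℝ) ^ (k + 1))
      = (a + (m : ℝ) / (M : ℝ) ^ k) / M := by
    push_cast; field_simp; ring
  rw [e1, ← hlpS_per M f k _ a, hlpS_prod]
  congr 1
  refine Finset.prod_congr rfl fun b _ => ?_
  congr 1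
  push_cast; field_simp; ring

lemma hlpU_norm (M : ℕ) (f : ℕ → ℂ) (k : ℕ) :
    ∑ l ∈ Finset.range (M ^ k), ‖hlpU M f k l‖ ^ 2
      = (∑ l ∈ Finset.range M, ‖f l‖ ^ 2) ^ k := by
  induction k with
  | zero => simp [hlpU]
  | succ k ih =>
    rw [pow_succ, hlp_sum_mul, pow_succ, ← ih, Finset.sum_mul_sum]
    refine Finset.sum_congr rfl fun m hm => Finset.sum_congr rfl fun a _ => ?_
    rw [hlpU_succ M f k m a (Finset.mem_range.1 hm), norm_mul, mul_pow]

lemma hlp_cantor_lt (M k : ℕ) (A : Finset ℕ) (hA : ∀ a ∈ A, a < M) :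
    ∀ l ∈ cantorC M k A, l < M ^ k := by
  induction k with
  | zero => simp [cantorC]
  | succ k ih =>
    intro l hl
    simp only [cantorC, Finset.mem_image, Fintype.mem_piFinset] at hl
    obtain ⟨d, hd, rfl⟩ := hl
    rw [Fin.sum_univ_castSucc]
    have h1 := ih (∑ j : Fin k, d j.castSucc * M ^ (j : ℕ)) (by
      simp only [cantorC, Finset.mem_image, Fintype.mem_piFinset]
      exact ⟨fun j => d j.castSucc, fun j => hd _, rfl⟩)
    have h2 := hA _ (hd (Fin.last k))
    simp only [Fin.val_castSucc, Fin.val_last]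
    have : (d (Fin.last k) + 1) * M ^ k ≤ M * M ^ k := Nat.mul_le_mul_right _ h2
    rw [pow_succ]
    nlinarith

lemma hlp_cantor_succ (M k : ℕ) (A : Finset ℕ) (hA : ∀ a ∈ A, a < M) (m a : ℕ)
    (hm : m < M ^ k) :
    m + M ^ k * a ∈ cantorC M (k + 1) A ↔ m ∈ cantorC M k A ∧ a ∈ A := by
  have h0 : 0 < M ^ k := by omega
  constructor
  · intro h
    simp only [cantorC, Finset.mem_image, Fintype.mem_piFinset] at h
    obtain ⟨d, hd, h⟩ := h
    rw [Fin.sum_univ_castSucc] at h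
    simp only [Fin.val_castSucc, Fin.val_last] at h
    have hmem : (∑ j : Fin k, d j.castSucc * M ^ (j : ℕ)) ∈ cantorC M k A := by
      simp only [cantorC, Finset.mem_image, Fintype.mem_piFinset]
      exact ⟨fun j => d j.castSucc, fun j => hd _, rfl⟩
    have hlt := hlp_cantor_lt M k A hA _ hmem
    set s := ∑ j : Fin k, d j.castSucc * M ^ (j : ℕ)
    rw [mul_comm (d _)] at h
    have e1 : s = m := by
      have := congrArg (· % M ^ k) h
      simpa [Nat.mod_eq_of_lt hm, Nat.mod_eq_of_lt hlt] using this
    have e2 : d (Fin.last k) = a := by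
      have := congrArg (· / M ^ k) h
      simpa [Nat.add_mul_div_left _ _ h0, Nat.div_eq_of_lt hm, Nat.div_eq_of_lt hlt] using this
    exact ⟨e1 ▸ hmem, e2 ▸ hd _⟩
  · rintro ⟨h1, h2⟩
    simp only [cantorC, Finset.mem_image, Fintype.mem_piFinset] at h1 ⊢
    obtain ⟨d, hd, rfl⟩ := h1
    refine ⟨Fin.snoc (α := fun _ => ℕ) d a, ?_, ?_⟩
    · intro j
      refine Fin.lastCases ?_ (fun i => ?_) j
      · simpa using h2
      · simpa using hd i
    · rw [Fin.sum_univ_castSucc]; simp [mul_comm]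

lemma hlpU_supp (M : ℕ) (A : Finset ℕ) (hA : ∀ a ∈ A, a < M) (f : ℕ → ℂ)
    (hf : ∀ l, l ∉ A → f l = 0) (k : ℕ) :
    ∀ l, l < M ^ k → l ∉ cantorC M k A → hlpU M f k l = 0 := by
  induction k with
  | zero => intro l hl h; exfalso; apply h; simp [cantorC]; rw [pow_zero] at hl; omega
  | succ k ih =>
    intro l hl h
    have h0 : 0 < M ^ k := by
      rcases Nat.eq_zero_or_pos (M ^ k) with h | h
      · rw [pow_succ, h] at hl; omega
      · exact h
    have hm := Nat.mod_lt l h0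
    rw [← Nat.mod_add_div l (M ^ k), hlp_cantor_succ M k A hA _ _ hm] at h
    rw [hlpU]
    by_cases h1 : l % M ^ k ∈ cantorC M k A
    · rw [hf _ (fun h2 => h ⟨h1, h2⟩), mul_zero]
    · rw [ih _ hm h1, zero_mul]

lemma hlp_T (M : ℕ) (hM : 0 < M) (A : Finset ℕ) (hA : ∀ a ∈ A, a < M) (f : ℕ → ℂ) (c : ℝ)
    (hc0 : 0 ≤ c)
    (hc : ∀ t : ℝ, 0 ≤ t → t < 1 → c ≤ ∑ a ∈ A, ‖hlpG M f ((a + t) / M)‖ ^ 2) (k : ℕ) :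
    c ^ k ≤ ∑ j ∈ Finset.range (M ^ k),
      if j ∈ cantorC M k A then ‖hlpS M f k (j / (M : ℝ) ^ k)‖ ^ 2 else 0 := by
  induction k with
  | zero => simp [cantorC, hlpS, hlpU, hlp_norm_ec]
  | succ k ih =>
    rw [pow_succ c, pow_succ M, hlp_sum_mul]
    refine (mul_le_mul_of_nonneg_right ih hc0).trans ?_
    rw [Finset.sum_mul]
    refine Finset.sum_le_sum fun m hm => ?_
    have hm := Finset.mem_range.1 hm
    have hMk : (0 : ℝ) < (M : ℝ) ^ k := by positivity
    simp only [hlp_cantor_succ M k A hA m _ hm, hlpS_step M hM]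
    by_cases h : m ∈ cantorC M k A
    · simp only [h, true_and, if_true]
      rw [← Finset.sum_filter]
      have : Finset.filter (fun a => a ∈ A) (Finset.range M) = A := by
        ext a; simp; exact hA a
      rw [this]
      simp only [norm_mul, mul_pow]
      rw [← Finset.mul_sum]
      refine mul_le_mul_of_nonneg_left (hc _ (by positivity) ?_) (by positivity)
      rw [div_lt_one hMk]; exact_mod_cast hm
    · simp [h]

lemma hlp_orth (M : ℕ) (hM : 0 < M) (l l' : ℕ) (hl : l < M) (hl' : l' < M) :
    ∑ a ∈ Finset.range M, ec (a * (((l : ℝ) - l') / M)) = if l = l' then (M : ℂ) else 0 := by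
  have hM' : (M : ℝ) ≠ 0 := by positivity
  split_ifs with h
  · subst h
    have : ec 0 = 1 := by simpa using hlp_ec_nat 0
    simp [this]
  · simp only [← hlp_ec_pow]
    have h1 : ec (((l : ℝ) - l') / M) ≠ 1 := by
      intro h2
      obtain ⟨n, hn⟩ := hlp_ec_eq_one h2
      rw [div_eq_iff hM'] at hn
      have hn : (l : ℤ) - l' = n * M := by exact_mod_cast hn
      have : |(l : ℤ) - l'| < M := by rw [abs_lt]; constructor <;> omega
      rw [hn, abs_mul, Nat.abs_cast] at this
      have : |n| < 1 := by
        by_contra h3; push Not at h3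
        nlinarith
      have : n = 0 := Int.abs_lt_one_iff.1 this
      subst this; omega
    rw [geom_sum_eq h1, hlp_ec_pow]
    have : ec (M * (((l : ℝ) - l') / M)) = 1 := by
      have e : (M : ℝ) * (((l : ℝ) - l') / M) = l + -l' := by field_simp; ring
      rw [e, hlp_ec_add, hlp_ec_nat, ← hlp_ec_conj, hlp_ec_nat]; simp
    rw [this]; simp

lemma hlp_parseval (M : ℕ) (hM : 0 < M) (f : ℕ → ℂ) (t : ℝ) :
    ∑ a ∈ Finset.range M, ‖hlpG M f ((a + t) / M)‖ ^ 2
      = M * ∑ l ∈ Finset.range M, ‖f l‖ ^ 2 := by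
  have key : (∑ a ∈ Finset.range M, ((‖hlpG M f ((a + t) / M)‖ : ℂ)) ^ 2)
      = M * ∑ l ∈ Finset.range M, (‖f l‖ : ℂ) ^ 2 := by
    simp only [← Complex.mul_conj']
    have : ∀ a : ℕ, hlpG M f ((a + t) / M) * (starRingEnd ℂ) (hlpG M f ((a + t) / M))
        = ∑ l ∈ Finset.range M, ∑ l' ∈ Finset.range M,
          f l * (starRingEnd ℂ) (f l') * ec (((l : ℝ) - l') * t / M) * ec (a * (((l : ℝ) - l') / M)) := by
      intro a
      unfold hlpG
      rw [map_sum, Finset.sum_mul_sum]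
      refine Finset.sum_congr rfl fun l _ => Finset.sum_congr rfl fun l' _ => ?_
      rw [map_mul, hlp_ec_conj, mul_assoc (f l * _), ← hlp_ec_add, mul_mul_mul_comm, ← hlp_ec_add]
      congr 2; ring
    simp only [this]
    rw [Finset.sum_comm, Finset.mul_sum]
    refine Finset.sum_congr rfl fun l hl => ?_
    rw [Finset.sum_comm]
    have hl := Finset.mem_range.1 hl
    rw [Finset.sum_eq_single l]
    · rw [← Finset.mul_sum, hlp_orth M hM l l hl hl]
      have : ec (((l : ℝ) - l) * t / M) = 1 := by simpa using hlp_ec_nat 0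
      rw [this]; simp; ring
    · intro l' hl' hne
      rw [← Finset.mul_sum, hlp_orth M hM l l' hl (Finset.mem_range.1 hl'), if_neg hne.symm, mul_zero]
    · intro h; simp [hl] at h
  exact_mod_cast key

lemma hlp_op (M : ℕ) (hM : 0 < M) (A : Finset ℕ) (hA : ∀ a ∈ A, a < M) (f : ℕ → ℂ)
    (hf : ∀ l, l ∉ A → f l = 0) (k : ℕ) :
    ∑ j ∈ Finset.range (M ^ k),
      (if j ∈ cantorC M k A then ‖hlpS M f k (j / (M : ℝ) ^ k)‖ ^ 2 else 0) ≤
    (M : ℝ) ^ k * (opNorm (indicatorMatrix (M ^ k) (cantorC M k A) * dftMatrix (M ^ k) *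
          indicatorMatrix (M ^ k) (cantorC M k A))) ^ 2 *
      (∑ l ∈ Finset.range M, ‖f l‖ ^ 2) ^ k := by
  set C := cantorC M k A with hC
  set B := indicatorMatrix (M ^ k) C * dftMatrix (M ^ k) * indicatorMatrix (M ^ k) C with hB
  let u : EuclideanSpace ℂ (Fin (M ^ k)) := WithLp.toLp 2 fun l => hlpU M f k l
  have hMk : (0 : ℝ) < (M : ℝ) ^ k := by positivity
  have h1 := (Matrix.toEuclideanCLM (𝕜 := ℂ) B).le_opNorm u
  have h2 : ‖u‖ ^ 2 = (∑ l ∈ Finset.range M, ‖f l‖ ^ 2) ^ k := by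
    rw [EuclideanSpace.norm_sq_eq, ← hlpU_norm, ← Fin.sum_univ_eq_sum_range (fun l => ‖hlpU M f k l‖ ^ 2)]
  have hco : ∀ j : Fin (M ^ k), (Matrix.toEuclideanCLM (𝕜 := ℂ) B u) j =
      if (j : ℕ) ∈ C then ((Real.sqrt ((M : ℝ) ^ k))⁻¹ : ℝ) * hlpS M f k ((j : ℕ) / (M : ℝ) ^ k) else 0 := by
    intro j
    have : (Matrix.toEuclideanCLM (𝕜 := ℂ) B u) j = (B.mulVec (fun l => hlpU M f k l)) j := by
      simp [u]
    rw [this, hB]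
    rw [← Matrix.mulVec_mulVec, ← Matrix.mulVec_mulVec]
    have hu : (indicatorMatrix (M ^ k) C).mulVec (fun l : Fin (M ^ k) => hlpU M f k l)
        = fun l : Fin (M ^ k) => hlpU M f k l := by
      ext l
      rw [indicatorMatrix, Matrix.mulVec_diagonal]
      split_ifs with h
      · simp
      · rw [hlpU_supp M A hA f hf k l l.2 h]; simp
    rw [hu, indicatorMatrix, Matrix.mulVec_diagonal]
    split_ifs with h
    · rw [one_mul, hlpS, Finset.mul_sum, ← Fin.sum_univ_eq_sum_range (fun l => (((Real.sqrt ((M : ℝ) ^ k))⁻¹ : ℝ) : ℂ) * (hlpU M f k l * ec (l * ((j : ℕ) / (M : ℝ) ^ k))))]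
      simp only [Matrix.mulVec, dotProduct, dftMatrix, Matrix.of_apply]
      refine Finset.sum_congr rfl fun l _ => ?_
      push_cast
      rw [show ((j : ℕ) : ℝ) * (l : ℕ) / (M : ℝ) ^ k = (l : ℕ) * ((j : ℕ) / (M : ℝ) ^ k) by ring]
      ring
    · simp
  have h3 : ‖Matrix.toEuclideanCLM (𝕜 := ℂ) B u‖ ^ 2 = ((M : ℝ) ^ k)⁻¹ * ∑ j ∈ Finset.range (M ^ k),
      (if j ∈ C then ‖hlpS M f k (j / (M : ℝ) ^ k)‖ ^ 2 else 0) := by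
    rw [EuclideanSpace.norm_sq_eq, Finset.mul_sum, ← Fin.sum_univ_eq_sum_range (fun j => ((M : ℝ) ^ k)⁻¹ * (if j ∈ C then ‖hlpS M f k (j / (M : ℝ) ^ k)‖ ^ 2 else 0))]
    refine Finset.sum_congr rfl fun j _ => ?_
    rw [hco]
    split_ifs with h
    · rw [norm_mul, mul_pow, Complex.norm_real, Real.norm_eq_abs, sq_abs, inv_pow, Real.sq_sqrt hMk.le]
    · simp
  have h4 := pow_le_pow_left₀ (norm_nonneg _) h1 2
  rw [mul_pow, h2, h3, inv_mul_le_iff₀ hMk] at h4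
  rw [mul_assoc]; exact h4

lemma hlp_choose_tail (M : ℕ) (hM : 0 < M) (l : ℕ) (hl : l ≤ M) :
    (M.choose l : ℝ) / 2 ^ M ≤ Real.exp (-(2 * ((l : ℝ) - M / 2) ^ 2 / M)) := by
  have hM' : (0 : ℝ) < M := by positivity
  set s : ℝ := (2 * l - M) / M with hs
  have h1 : Real.exp s ^ l * Real.exp (-s) ^ (M - l) * M.choose l ≤ (Real.exp s + Real.exp (-s)) ^ M := by
    rw [add_pow]
    exact Finset.single_le_sum (f := fun m => Real.exp s ^ m * Real.exp (-s) ^ (M - m) * (M.choose m : ℝ))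
      (fun i _ => by positivity) (Finset.mem_range.2 (by omega))
  have h2 : Real.exp s + Real.exp (-s) ≤ 2 * Real.exp (s ^ 2 / 2) := by
    have := Real.cosh_le_exp_half_sq s
    rw [Real.cosh_eq] at this; linarith
  have h3 := h1.trans (pow_le_pow_left₀ (by positivity) h2 M)
  rw [mul_pow, ← Real.exp_nat_mul, ← Real.exp_nat_mul, ← Real.exp_nat_mul, ← Real.exp_add,
    Nat.cast_sub hl] at h3
  rw [div_le_iff₀ (by positivity)]
  have h4 : (M.choose l : ℝ) = Real.exp (-(l * s + (M - l) * -s)) *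
      (Real.exp (l * s + (M - l) * -s) * M.choose l) := by
    rw [← mul_assoc, ← Real.exp_add]; simp
  rw [h4]
  refine (mul_le_mul_of_nonneg_left h3 (Real.exp_pos _).le).trans (le_of_eq ?_)
  rw [mul_left_comm, ← Real.exp_add, mul_comm]
  congr 2
  rw [hs]; field_simp; ring

lemma hlp_sin (x : ℝ) (h0 : 0 ≤ x) (h1 : x ≤ 1) :
    ‖(1 - ec x) / 2‖ ≤ Real.exp (-(2 * (x - 1 / 2) ^ 2)) := by
  have e : ec x = Complex.exp (Complex.I * ((-(2 * Real.pi * x) : ℝ) : ℂ)) := by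
    unfold ec; congr 1; push_cast; ring
  rw [norm_div, norm_sub_rev, e, Complex.norm_exp_I_mul_ofReal_sub_one]
  have hp := Real.pi_pos
  have e2 : Real.sin (-(2 * Real.pi * x) / 2) = - Real.cos (Real.pi * (x - 1 / 2)) := by
    rw [show -(2 * Real.pi * x) / 2 = -(Real.pi * (x - 1 / 2) + Real.pi / 2) by ring,
      Real.sin_neg, Real.sin_add_pi_div_two]
  have hc : 0 ≤ Real.cos (Real.pi * (x - 1 / 2)) :=
    Real.cos_nonneg_of_mem_Icc ⟨by nlinarith, by nlinarith⟩
  have hq := Real.cos_le_one_sub_mul_cos_sq (x := Real.pi * (x - 1 / 2))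
    (by rw [abs_le]; constructor <;> nlinarith)
  rw [e2, norm_mul, norm_neg, Real.norm_of_nonneg hc]
  have e3 : 2 / Real.pi ^ 2 * (Real.pi * (x - 1 / 2)) ^ 2 = 2 * (x - 1 / 2) ^ 2 := by
    field_simp
  rw [e3] at hq
  have := Real.add_one_le_exp (-(2 * (x - 1 / 2) ^ 2))
  simp
  simp at hq this
  linarith

/-- the trial function -/
def hlpF (M : ℕ) (A : Finset ℕ) (l : ℕ) : ℂ :=
  if l ∈ A then (-1) ^ l * (((M.choose l : ℝ) / 2 ^ M : ℝ) : ℂ) else 0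

lemma hlp_G_bound (M : ℕ) (hM : 0 < M) (A : Finset ℕ) (hA : ∀ a ∈ A, a < M) (E : ℝ)
    (hE : ∀ l, l ≤ M → l ∉ A → (M.choose l : ℝ) / 2 ^ M ≤ E) (x : ℝ) (h0 : 0 ≤ x) (h1 : x ≤ 1)
    (hx : Real.exp (-(2 * (x - 1 / 2) ^ 2)) ^ M ≤ 8 * E) :
    ‖hlpG M (hlpF M A) x‖ ≤ (M + 9) * E := by
  have hfull : ∑ l ∈ Finset.range (M + 1), (-1) ^ l * (((M.choose l : ℝ) / 2 ^ M : ℝ) : ℂ) * ec (l * x)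
      = ((1 - ec x) / 2) ^ M := by
    rw [div_pow, sub_eq_neg_add, add_pow, Finset.sum_div]
    refine Finset.sum_congr rfl fun l _ => ?_
    rw [← hlp_ec_pow, neg_pow (ec x)]; push_cast; ring
  have hsplit : hlpG M (hlpF M A) x = ((1 - ec x) / 2) ^ M - ∑ l ∈ Finset.range (M + 1),
      if l ∈ A then 0 else (-1) ^ l * (((M.choose l : ℝ) / 2 ^ M : ℝ) : ℂ) * ec (l * x) := by
    have hMA : M ∉ A := fun h => lt_irrefl _ (hA M h)
    have : hlpG M (hlpF M A) x = ∑ l ∈ Finset.range (M + 1), hlpF M A l * ec (l * x) := by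
      rw [Finset.sum_range_succ, hlpG, hlpF, if_neg hMA]; simp
    rw [this, ← hfull, ← Finset.sum_sub_distrib]
    refine Finset.sum_congr rfl fun l _ => ?_
    unfold hlpF
    split_ifs <;> simp
  have hE0 : 0 ≤ E := by
    have : 0 ≤ Real.exp (-(2 * (x - 1 / 2) ^ 2)) ^ M := by positivity
    linarith
  rw [hsplit]
  refine (norm_sub_le _ _).trans ?_
  have b1 : ‖((1 - ec x) / 2) ^ M‖ ≤ 8 * E := by
    rw [norm_pow]
    exact (pow_le_pow_left₀ (norm_nonneg _) (hlp_sin x h0 h1) M).trans hx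
  have b2 : ‖∑ l ∈ Finset.range (M + 1),
      if l ∈ A then 0 else (-1) ^ l * (((M.choose l : ℝ) / 2 ^ M : ℝ) : ℂ) * ec (l * x)‖ ≤ (M + 1) * E := by
    refine (norm_sum_le_of_le _ (f := fun l => if l ∈ A then 0 else (-1) ^ l * (((M.choose l : ℝ) / 2 ^ M : ℝ) : ℂ) * ec (l * x)) (n := fun _ => E) fun l hl => ?_).trans (le_of_eq ?_)
    · split_ifs with h
      · simpa using hE0
      · rw [norm_mul, norm_mul, hlp_norm_ec, Complex.norm_real, Real.norm_of_nonneg (by positivity)]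
        simp only [norm_pow, norm_neg, norm_one, one_pow, one_mul, mul_one]
        exact hE l (by have := Finset.mem_range.1 hl; omega) h
    · simp
  linarith

lemma hlp_F_norm (M : ℕ) (hM : 0 < M) (A : Finset ℕ) (hA : ∀ a ∈ A, a < M) (hmid : M / 2 ∈ A) :
    1 / ((M : ℝ) + 1) ^ 2 ≤ ∑ l ∈ Finset.range M, ‖hlpF M A l‖ ^ 2 := by
  have h1 := Finset.single_le_sum (f := fun l => ‖hlpF M A l‖ ^ 2) (s := Finset.range M)
      (fun i _ => by positivity) (Finset.mem_range.2 (hA _ hmid))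
  refine le_trans ?_ h1
  have h2 : (2 : ℝ) ^ M ≤ (M + 1) * M.choose (M / 2) := by
    have : 2 ^ M ≤ (M + 1) * M.choose (M / 2) := by
      rw [← Nat.sum_range_choose]
      refine (Finset.sum_le_card_nsmul _ _ _ fun i _ => Nat.choose_le_middle i M).trans ?_
      simp
    exact_mod_cast this
  simp only [hlpF, if_pos hmid]
  rw [norm_mul, Complex.norm_real, Real.norm_of_nonneg (by positivity)]
  simp only [norm_pow, norm_neg, norm_one, one_pow, one_mul]
  rw [← one_div_pow]
  refine pow_le_pow_left₀ (by positivity) ?_ 2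
  rw [div_le_div_iff₀ (by positivity) (by positivity)]
  linarith

lemma hlp_core (M : ℕ) (hM : 0 < M) (A : Finset ℕ) (hA : ∀ a ∈ A, a < M) (hmid : M / 2 ∈ A)
    (E : ℝ) (hE : ∀ l, l ≤ M → l ∉ A → (M.choose l : ℝ) / 2 ^ M ≤ E)
    (hx : ∀ a t, a < M → a ∉ A → 0 ≤ t → t < 1 →
      Real.exp (-(2 * (((a : ℝ) + t) / M - 1 / 2) ^ 2)) ^ M ≤ 8 * E)
    (hs : (M + 9) ^ 4 * E ^ 2 ≤ 1) (k : ℕ) :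
    (1 - (M + 9) ^ 4 * E ^ 2) ^ k ≤
      (opNorm (indicatorMatrix (M ^ k) (cantorC M k A) * dftMatrix (M ^ k) *
          indicatorMatrix (M ^ k) (cantorC M k A))) ^ 2 := by
  have hM' : (0 : ℝ) < M := by positivity
  set W := ∑ l ∈ Finset.range M, ‖hlpF M A l‖ ^ 2 with hW
  have hWl := hlp_F_norm M hM A hA hmid
  rw [← hW] at hWl
  have hW0 : 0 < W := lt_of_lt_of_le (by positivity) hWl
  set ε : ℝ := (M + 9) ^ 4 * E ^ 2 with hε
  have hE0 : 0 ≤ E := le_trans (by positivity) (hE M le_rfl (fun h => lt_irrefl _ (hA M h)))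
  have hT := hlp_T M hM A hA (hlpF M A) (M * W * (1 - ε)) (by
      have : 0 ≤ 1 - ε := by linarith
      positivity) (by
    intro t ht0 ht1
    have hp := hlp_parseval M hM (hlpF M A) t
    rw [← hW, ← Finset.sum_filter_add_sum_filter_not (Finset.range M) (fun a => a ∈ A)] at hp
    have e : Finset.filter (fun a => a ∈ A) (Finset.range M) = A := by
      ext a; simp; exact hA a
    rw [e] at hp
    have hb : ∑ a ∈ Finset.filter (fun a => a ∉ A) (Finset.range M),
        ‖hlpG M (hlpF M A) ((a + t) / M)‖ ^ 2 ≤ M * ((M + 9) * E) ^ 2 := by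
      refine (Finset.sum_le_card_nsmul _ _ (((M + 9) * E) ^ 2) fun a ha => ?_).trans ?_
      · rw [Finset.mem_filter, Finset.mem_range] at ha
        refine pow_le_pow_left₀ (norm_nonneg _) (hlp_G_bound M hM A hA E hE _ (by positivity) ?_
          (hx a t ha.1 ha.2 ht0 ht1)) 2
        rw [div_le_one hM']
        have : (a : ℝ) + 1 ≤ M := by exact_mod_cast ha.1
        linarith
      · rw [nsmul_eq_mul]
        refine mul_le_mul_of_nonneg_right ?_ (by positivity)
        have := Finset.card_filter_le (Finset.range M) (fun a => a ∉ A)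
        rw [Finset.card_range] at this
        exact_mod_cast this
    have hb2 : ((M + 9) * E) ^ 2 ≤ W * ε := by
      calc ((M + 9) * E) ^ 2 = 1 / ((M : ℝ) + 9) ^ 2 * ε := by rw [hε]; field_simp
        _ ≤ 1 / ((M : ℝ) + 1) ^ 2 * ε := by
          refine mul_le_mul_of_nonneg_right ?_ (by positivity)
          refine one_div_le_one_div_of_le (by positivity) ?_
          exact pow_le_pow_left₀ (by positivity) (by linarith) 2
        _ ≤ W * ε := mul_le_mul_of_nonneg_right hWl (by positivity)
    have := mul_le_mul_of_nonneg_left hb2 hM'.le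
    nlinarith) k
  have hO := hT.trans (hlp_op M hM A hA (hlpF M A) (fun l h => by simp [hlpF, h]) k)
  rw [← hW, mul_pow, mul_pow, mul_right_comm _ _ (W ^ k)] at hO
  exact le_of_mul_le_mul_left hO (by positivity)

lemma hlp_large (p c : ℝ) (hp : 0 < p) (hc : 0 < c) :
    ∀ᶠ M : ℕ in Filter.atTop, ((M : ℝ) + 9) ^ 4 * Real.exp (-c * (M : ℝ) ^ p) ≤ 1 / 2 := by
  have h1 := (isLittleO_exp_neg_mul_rpow_atTop hc (-(4 / p))).bound
    (show (0 : ℝ) < 1 / 20000 by norm_num)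
  have h2 : Filter.Tendsto (fun M : ℕ => (M : ℝ) ^ p) Filter.atTop Filter.atTop :=
    (tendsto_rpow_atTop hp).comp tendsto_natCast_atTop_atTop
  filter_upwards [h2.eventually h1, Filter.eventually_ge_atTop 1] with M hM h1
  have hM1 : (1 : ℝ) ≤ M := by exact_mod_cast h1
  have hM0 : (0 : ℝ) < M := by linarith
  rw [Real.norm_of_nonneg (by positivity), Real.norm_of_nonneg (by positivity),
    ← Real.rpow_mul hM0.le, show p * -(4 / p) = -((4 : ℕ) : ℝ) by push_cast; field_simp,
    Real.rpow_neg hM0.le, Real.rpow_natCast] at hM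
  have h3 : ((M : ℝ) + 9) ^ 4 ≤ (10 * M) ^ 4 := pow_le_pow_left₀ (by positivity) (by linarith) 4
  calc ((M : ℝ) + 9) ^ 4 * Real.exp (-c * (M : ℝ) ^ p)
      ≤ (10 * M) ^ 4 * (1 / 20000 * ((M : ℝ) ^ 4)⁻¹) :=
        mul_le_mul h3 hM (by positivity) (by positivity)
    _ = 1 / 2 := by field_simp; norm_num

set_option maxHeartbeats 2000000 in
/-- For `1/2 < δ < 1`, there is `M₀` such that for all `M ≥ M₀`, with the
alphabet `A = { l : |l - M/2| ≤ M^δ/2 }`, for every `k ≥ 1` one has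
`‖𝟙_{C_k} F_{M^k} 𝟙_{C_k}‖ ≥ (M^k)^{-β₀}` where `β₀ = 170 e^{-(π/4) M^{2δ-1}}`. -/
theorem stmt0 (δ : ℝ) (hδ1 : 1 / 2 < δ) (hδ2 : δ < 1) :
    ∃ M₀ : ℕ, ∀ M : ℕ, M₀ ≤ M → ∀ k : ℕ, 1 ≤ k →
      ((M : ℝ) ^ k) ^ (-(170 * Real.exp (-(Real.pi / 4) * (M : ℝ) ^ (2 * δ - 1)))) ≤
        opNorm (indicatorMatrix (M ^ k) (cantorC M k (alphabetA M δ)) * dftMatrix (M ^ k) *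
          indicatorMatrix (M ^ k) (cantorC M k (alphabetA M δ))) := by
  have hpi : Real.pi / 4 < 1 := by linarith [Real.pi_lt_four]
  have hev := (hlp_large (2 * δ - 1) (1 - Real.pi / 4) (by linarith) (by linarith)).and
    (Filter.eventually_ge_atTop 3)
  obtain ⟨M₀, hM₀⟩ := Filter.eventually_atTop.1 hev
  refine ⟨M₀, fun M hM k _ => ?_⟩
  obtain ⟨hsm, h3⟩ := hM₀ M hM
  have h3' : (3 : ℝ) ≤ M := by exact_mod_cast h3
  have hMp : 0 < M := by omega
  have hM0 : (0 : ℝ) < M := by linarith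
  set X : ℝ := (M : ℝ) ^ (2 * δ - 1) with hX
  have hX0 : 0 < X := by positivity
  set E := Real.exp (-(X / 2)) with hE
  set D : ℝ := (M : ℝ) ^ δ / 2 with hD
  have hD0 : 0 < D := by positivity
  have hMd1 : 1 ≤ (M : ℝ) ^ δ := Real.one_le_rpow (by linarith) (by linarith)
  have hMd2 : (M : ℝ) ^ δ ≤ M := by
    simpa using Real.rpow_le_rpow_of_exponent_le (show (1 : ℝ) ≤ M by linarith) hδ2.le
  have hMd3 : (M : ℝ) ^ δ < M := by
    simpa using Real.rpow_lt_rpow_of_exponent_lt (show (1 : ℝ) < M by linarith) hδ2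
  have hDX : D ^ 2 = X * M / 4 := by
    rw [hD, hX, div_pow, ← Real.rpow_natCast ((M : ℝ) ^ δ), ← Real.rpow_mul hM0.le]
    have : (M : ℝ) ^ (2 * δ - 1) * M = (M : ℝ) ^ (2 * δ - 1 + 1) := by
      rw [Real.rpow_add_one hM0.ne']
    rw [this]; norm_num; ring_nf
  set A := alphabetA M δ with hAdef
  have hA : ∀ a ∈ A, a < M := fun a ha => by
    simp only [hAdef, alphabetA, Finset.mem_filter, Finset.mem_range] at ha; exact ha.1
  have hAn : ∀ a, a ≤ M → a ∉ A → D < |(a : ℝ) - M / 2| := by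
    intro a ha hn
    rcases ha.lt_or_eq with h | h
    · by_contra h2
      push Not at h2
      exact hn (by simp only [hAdef, alphabetA, Finset.mem_filter, Finset.mem_range]; exact ⟨h, h2⟩)
    · subst h
      rw [show (a : ℝ) - a / 2 = a / 2 by ring, abs_of_nonneg (by positivity)]
      linarith
  have hmid : M / 2 ∈ A := by
    simp only [hAdef, alphabetA, Finset.mem_filter, Finset.mem_range]
    refine ⟨by omega, ?_⟩
    have e1 : 2 * (M / 2) ≤ M := by omega
    have e2 : M ≤ 2 * (M / 2) + 1 := by omega
    have e1' : 2 * ((M / 2 : ℕ) : ℝ) ≤ M := by exact_mod_cast e1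
    have e2' : (M : ℝ) ≤ 2 * ((M / 2 : ℕ) : ℝ) + 1 := by exact_mod_cast e2
    rw [abs_le]; constructor <;> linarith
  have hcore := hlp_core M hMp A hA hmid E (by
      intro l hl hn
      refine (hlp_choose_tail M hMp l hl).trans (Real.exp_le_exp.2 (neg_le_neg ?_))
      have h := hAn l hl hn
      have : D ^ 2 ≤ ((l : ℝ) - M / 2) ^ 2 := by
        rw [← sq_abs ((l : ℝ) - M / 2)]
        exact pow_le_pow_left₀ hD0.le h.le 2
      rw [le_div_iff₀ hM0]
      nlinarith) (by
      intro a t ha hn ht0 ht1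
      have h := hAn a ha.le hn
      have e8 : Real.exp 2 ≤ 8 := by
        have := Real.exp_one_lt_d9
        have e : Real.exp 2 = Real.exp 1 ^ 2 := by rw [← Real.exp_nat_mul]; norm_num
        rw [e]
        nlinarith [Real.exp_pos 1]
      have : 8 * E ≥ Real.exp (2 - X / 2) := by
        rw [sub_eq_add_neg, Real.exp_add]
        exact mul_le_mul_of_nonneg_right e8 (Real.exp_pos _).le
      refine le_trans ?_ this
      rw [← Real.exp_nat_mul, Real.exp_le_exp]
      set y : ℝ := (a : ℝ) + t - M / 2 with hy
      have hy1 : D - 1 ≤ |y| := by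
        have := abs_sub_abs_le_abs_sub ((a : ℝ) - M / 2) y
        have e : (a : ℝ) - M / 2 - y = -t := by rw [hy]; ring
        rw [e, abs_neg, abs_of_nonneg ht0] at this
        linarith
      have hy2 : D ^ 2 - 2 * D ≤ y ^ 2 := by
        rw [← sq_abs y]
        rcases le_or_gt D 1 with h | h
        · nlinarith [sq_nonneg |y|]
        · nlinarith [abs_nonneg y]
      have e : ((a : ℝ) + t) / M - 1 / 2 = y / M := by rw [hy]; field_simp
      rw [e]
      have e2 : (M : ℝ) * -(2 * (y / M) ^ 2) = -(2 * y ^ 2 / M) := by field_simp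
      rw [e2]
      have : X / 2 - 2 ≤ 2 * y ^ 2 / M := by
        rw [le_div_iff₀ hM0]
        nlinarith
      linarith)
  have hE2 : E ^ 2 = Real.exp (-X) := by
    rw [hE, ← Real.exp_nat_mul]; congr 1; push_cast; ring
  set Q := Real.exp (-(Real.pi / 4) * X) with hQ
  have hQ0 : 0 < Q := Real.exp_pos _
  have hQ1 : Q ≤ 1 := by
    rw [hQ, Real.exp_le_one_iff]; nlinarith [Real.pi_pos]
  set ε : ℝ := (M + 9) ^ 4 * E ^ 2 with hε
  have hε0 : 0 ≤ ε := by positivity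
  have hεQ : ε ≤ Q / 2 := by
    have : ε = ((M : ℝ) + 9) ^ 4 * Real.exp (-(1 - Real.pi / 4) * X) * Q := by
      rw [hε, hE2, hQ, mul_assoc, ← Real.exp_add]; congr 2; ring
    rw [this]; nlinarith
  have hc := hcore (by linarith) k
  set R := opNorm (indicatorMatrix (M ^ k) (cantorC M k A) * dftMatrix (M ^ k) *
          indicatorMatrix (M ^ k) (cantorC M k A)) with hR
  have hR0 : 0 ≤ R := norm_nonneg _
  have hlog : 1 ≤ Real.log M := by
    rw [Real.le_log_iff_exp_le hM0]
    linarith [Real.exp_one_lt_d9]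
  have h1e : Real.exp (-(2 * ε)) ≤ 1 - ε := by
    rw [Real.exp_neg, inv_le_comm₀ (Real.exp_pos _) (by linarith)]
    refine le_trans ?_ (Real.add_one_le_exp (2 * ε))
    rw [inv_le_iff_one_le_mul₀ (by linarith)]
    nlinarith
  refine (fun h hb => (abs_le_of_sq_le_sq' h hb).2) ?_ hR0
  refine le_trans ?_ hc
  have e : (((M : ℝ) ^ k) ^ (-(170 * Q))) ^ 2 = Real.exp (-(340 * Q * Real.log M)) ^ k := by
    rw [Real.rpow_def_of_pos (by positivity), Real.log_pow, ← Real.exp_nat_mul, ← Real.exp_nat_mul]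
    congr 1; push_cast; ring
  rw [e]
  refine pow_le_pow_left₀ (Real.exp_pos _).le (le_trans (Real.exp_le_exp.2 ?_) h1e) k
  nlinarith

end
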